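/- Fix a natural number n and let I ⊆ J ⊆ {0,…,n−1}, with J^c = {0,…,n−1}∖J the complement of J. Then σ(J∖I, I) · σ(J, J^c) = σ(J∖I, I∪J^c) · σ(I, J^c). (This is the signature identity of Appendix A.2 proving that the left interior product can be expressed through the exterior product and the Hodge complement: e_I ⌐ e_J = (e_I ∧ e_J^H)^{H⁻¹}.) -/

import Mathlib

/-- Number of "inversion" pairs (a,b) ∈ A × B with b < a. -/
def invCount (A B : Finset ℕ) : ℕ :=
  ((A ×ˢ B).filter (fun p => p.2 < p.1)).card

/-- The signature σ(A,B) = (−1)^{N(A,B)} of the permutation sorting the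
concatenation of the increasing enumerations of A and B. -/
def sortSign (A B : Finset ℕ) : ℤ :=
  (-1) ^ invCount A B

theorem sortSign_union_left {A B : Finset ℕ} (h : Disjoint A B) (C : Finset ℕ) :
    sortSign (A ∪ B) C = sortSign A C * sortSign B C := by
  unfold sortSign invCount
  rw [Finset.union_product, Finset.filter_union, Finset.card_union_of_disjoint, pow_add]
  exact Finset.disjoint_filter_filter (Finset.disjoint_product.2 (Or.inl h))

theorem sortSign_union_right (A : Finset ℕ) {B C : Finset ℕ} (h : Disjoint B C) :
    sortSign A (B ∪ C) = sortSign A B * sortSign A C := by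
  unfold sortSign invCount
  rw [Finset.product_union, Finset.filter_union, Finset.card_union_of_disjoint, pow_add]
  exact Finset.disjoint_filter_filter (Finset.disjoint_product.2 (Or.inr h))

theorem left_interior_hodge_signature (n : ℕ) (I J : Finset ℕ)
    (hIJ : I ⊆ J) (hJ : J ⊆ Finset.range n) :
    sortSign (J \ I) I * sortSign J (Finset.range n \ J) =
      sortSign (J \ I) (I ∪ (Finset.range n \ J)) *
        sortSign I (Finset.range n \ J) := by
  have hJC : sortSign J (Finset.range n \ J) =
      sortSign (J \ I) (Finset.range n \ J) * sortSign I (Finset.range n \ J) := by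
    rw [← sortSign_union_left Finset.sdiff_disjoint, Finset.sdiff_union_of_subset hIJ]
  rw [hJC, sortSign_union_right _ (Finset.disjoint_sdiff.mono_left hIJ), mul_assoc]
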